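/- arXiv:1409.7983 — 2 statements merged into one kernel-verified Lean document; each statement's English description precedes it below -/
import Mathlib

section
/- Let k ≥ 2 be an integer and let 0 < j ≤ 2^(k−2). Then there exists a set C of exactly j even-weight vertices of Q_k such that for every odd-weight vertex v of Q_k, the graph obtained from Q_k by deleting C contains a path of length 2^k − 2j starting at v. -/
open SimpleGraph

/-- The hypercube graph `Q_n` on vertex set `{0,1}^n`: two vertices are adjacent
iff they differ in exactly one coordinate. -/
def hypercube (n : ℕ) : SimpleGraph (Fin n → Bool) :=
  SimpleGraph.fromRel (fun u v => hammingDist u v = 1)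

/-- `HasCopy H G` means `H` contains a subgraph isomorphic to `G`. -/
def HasCopy {V W : Type*} (H : SimpleGraph V) (G : SimpleGraph W) : Prop :=
  ∃ f : G →g H, Function.Injective f

/-- `IsSat Host H G`: `H` is an `(Host, G)`-saturated subgraph of `Host`. -/
def IsSat {V W : Type*} (Host H : SimpleGraph V) (G : SimpleGraph W) : Prop :=
  H ≤ Host ∧ ¬ HasCopy H G ∧
    ∀ u v : V, Host.Adj u v → ¬ H.Adj u v →
      HasCopy (H ⊔ SimpleGraph.fromEdgeSet {s(u, v)}) G

/-- The saturation number `sat(Host, G)`. -/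
noncomputable def satNum {V W : Type*} (Host : SimpleGraph V) (G : SimpleGraph W) : ℕ :=
  sInf { m | ∃ H : SimpleGraph V, IsSat Host H G ∧ H.edgeSet.ncard = m }

/-- The weight of a vertex of the hypercube: its number of `1` coordinates. -/
def wt {k : ℕ} (v : Fin k → Bool) : ℕ := (Finset.univ.filter (fun i => v i = true)).card

lemma hypercube_adj {n : ℕ} {u v : Fin n → Bool} :
    (hypercube n).Adj u v ↔ hammingDist u v = 1 := by
  rw [hypercube, SimpleGraph.fromRel_adj, hammingDist_comm v u, or_self]
  refine ⟨fun h => h.2, fun h => ⟨?_, h⟩⟩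
  rintro rfl
  simp at h

lemma hammingDist_insertNth {n : ℕ} (i : Fin (n + 1)) (a b : Bool) (u v : Fin n → Bool) :
    hammingDist (i.insertNth a u : Fin (n + 1) → Bool) (i.insertNth b v) =
      (if a ≠ b then 1 else 0) + hammingDist u v := by
  simp only [hammingDist, Finset.card_filter]
  rw [Fin.sum_univ_succAbove _ i]
  simp

lemma wt_insertNth {n : ℕ} (i : Fin (n + 1)) (a : Bool) (u : Fin n → Bool) :
    wt (i.insertNth a u : Fin (n + 1) → Bool) = (if a = true then 1 else 0) + wt u := by
  simp only [wt, Finset.card_filter]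
  rw [Fin.sum_univ_succAbove _ i]
  simp

lemma hammingDist_cons {n : ℕ} (a b : Bool) (u v : Fin n → Bool) :
    hammingDist (Fin.cons a u : Fin (n + 1) → Bool) (Fin.cons b v) =
      (if a ≠ b then 1 else 0) + hammingDist u v := by
  simpa using hammingDist_insertNth 0 a b u v

lemma wt_cons {n : ℕ} (a : Bool) (u : Fin n → Bool) :
    wt (Fin.cons a u : Fin (n + 1) → Bool) = (if a = true then 1 else 0) + wt u := by
  simpa using wt_insertNth 0 a u

lemma wt_mod_two_ne_of_adj {n : ℕ} {u v : Fin n → Bool} (h : (hypercube n).Adj u v) :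
    wt u % 2 ≠ wt v % 2 := by
  have key : ∀ {m : ℕ} (x y : Fin m → Bool), (wt x + wt y + hammingDist x y) % 2 = 0 := by
    intro m
    induction m with
    | zero => intro x y; simp [wt, hammingDist]
    | succ m ih =>
      intro x y
      have := ih (Fin.tail x) (Fin.tail y)
      rw [← Fin.cons_self_tail x, ← Fin.cons_self_tail y, wt_cons, wt_cons, hammingDist_cons]
      cases x 0 <;> cases y 0 <;> simp <;> omega
  have := key u v
  rw [hypercube_adj] at h
  omega

/-- The hypercube is Hamilton-laceable: vertices of opposite parity are joined by a
Hamiltonian path. -/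
lemma exists_hamiltonian_list {n : ℕ} (u v : Fin n → Bool) (h : wt u % 2 ≠ wt v % 2) :
    ∃ l : List (Fin n → Bool), l.IsChain (hypercube n).Adj ∧ l.Nodup ∧ (∀ x, x ∈ l) ∧
      l.head? = some u ∧ l.getLast? = some v := by
  induction n with
  | zero => exact absurd (congrArg (fun x => wt x % 2) (Subsingleton.elim u v)) h
  | succ n ih =>
    obtain ⟨i, hi⟩ : ∃ i, u i ≠ v i := by
      by_contra! hc
      exact h (by rw [funext hc])
    obtain ⟨a, u, rfl⟩ : ∃ a u', u = (i.insertNth a u' : Fin (n + 1) → Bool) :=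
      ⟨u i, i.removeNth u, by simp⟩
    obtain ⟨b, v, rfl⟩ : ∃ b v', v = (i.insertNth b v' : Fin (n + 1) → Bool) :=
      ⟨v i, i.removeNth v, by simp⟩
    simp only [Fin.insertNth_apply_same] at hi
    rw [wt_insertNth, wt_insertNth] at h
    have hinj : ∀ c : Bool, Function.Injective
        (fun x : Fin n → Bool => (i.insertNth c x : Fin (n + 1) → Bool)) :=
      fun c => Fin.insertNth_right_injective (α := fun _ => Bool) (p := i) c
    have hchain : ∀ (c : Bool) (l : List (Fin n → Bool)), l.IsChain (hypercube n).Adj →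
        (l.map (fun x => (i.insertNth c x : Fin (n + 1) → Bool))).IsChain
          (hypercube (n + 1)).Adj := by
      intro c l hl
      rw [List.isChain_map]
      refine hl.imp fun x y hxy => ?_
      rw [hypercube_adj] at hxy ⊢
      simp [hammingDist_insertNth, hxy]
    -- Hamiltonian paths of the two facets, joined by an edge in direction `i`
    obtain ⟨l₁, l₂, w, c₁, c₂, d₁, d₂, m₁, m₂, s₁, t₁, s₂, t₂⟩ :
        ∃ (l₁ l₂ : List (Fin n → Bool)) (w : Fin n → Bool),
          l₁.IsChain (hypercube n).Adj ∧ l₂.IsChain (hypercube n).Adj ∧ l₁.Nodup ∧ l₂.Nodup ∧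
          (∀ x, x ∈ l₁) ∧ (∀ x, x ∈ l₂) ∧ l₁.head? = some u ∧ l₁.getLast? = some w ∧
          l₂.head? = some w ∧ l₂.getLast? = some v := by
      cases n with
      | zero =>
        refine ⟨[u], [v], u, ?_⟩
        simp [Subsingleton.elim _ u]
      | succ m =>
        obtain ⟨w, hw⟩ : ∃ w : Fin (m + 1) → Bool, wt u % 2 ≠ wt w % 2 := by
          refine ⟨Fin.cons (!u 0) (Fin.tail u), ?_⟩
          conv_lhs => rw [← Fin.cons_self_tail u]
          rw [wt_cons, wt_cons]
          cases u 0 <;> simp <;> omega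
        obtain ⟨l₁, c₁, d₁, m₁, s₁, t₁⟩ := ih u w hw
        obtain ⟨l₂, c₂, d₂, m₂, s₂, t₂⟩ := ih w v (by
          cases a <;> cases b <;> simp at hi h <;> omega)
        exact ⟨l₁, l₂, w, c₁, c₂, d₁, d₂, m₁, m₂, s₁, t₁, s₂, t₂⟩
    refine ⟨l₁.map (fun x => i.insertNth a x) ++ l₂.map (fun x => i.insertNth b x),
      ?_, ?_, ?_, ?_, ?_⟩
    · refine (hchain a l₁ c₁).append (hchain b l₂ c₂) ?_
      simp [t₁, s₂, hypercube_adj, hammingDist_insertNth, hi]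
    · refine (d₁.map (hinj a)).append (d₂.map (hinj b)) ?_
      intro x hx hy
      simp only [List.mem_map] at hx hy
      obtain ⟨x, -, rfl⟩ := hx
      obtain ⟨y, -, hy⟩ := hy
      exact hi (by simpa using (congrFun hy i).symm)
    · intro x
      have h : x i = a ∨ x i = b := by
        revert hi; cases a <;> cases b <;> cases x i <;> simp
      rcases h with rfl | rfl
      · exact List.mem_append_left _
          (List.mem_map.2 ⟨i.removeNth x, m₁ _, Fin.insertNth_self_removeNth i x⟩)
      · exact List.mem_append_right _
          (List.mem_map.2 ⟨i.removeNth x, m₂ _, Fin.insertNth_self_removeNth i x⟩)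
    · simp [s₁]
    · simp [t₂]

lemma exists_walk_induce_of_isChain {V : Type*} {G : SimpleGraph V} {s : Set V} (v : V)
    (l : List V) (hl : (v :: l).IsChain G.Adj) (hs : ∀ x ∈ v :: l, x ∈ s) (hv : v ∈ s) :
    ∃ (y : s) (p : (G.induce s).Walk ⟨v, hv⟩ y), p.support.map Subtype.val = v :: l := by
  induction l generalizing v with
  | nil => exact ⟨_, .nil, by simp⟩
  | cons w l ih =>
    rw [List.isChain_cons_cons] at hl
    have hw : w ∈ s := hs w (by simp)
    obtain ⟨y, p, hp⟩ := ih w hl.2 (fun x hx => hs x (List.mem_cons_of_mem _ hx)) hw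
    exact ⟨y, .cons (by simpa using hl.1) p, by simp [hp]⟩

lemma exists_isPath_induce_of_isChain {V : Type*} {G : SimpleGraph V} {s : Set V} (v : V)
    (l : List V) (hl : (v :: l).IsChain G.Adj) (hd : (v :: l).Nodup)
    (hs : ∀ x ∈ v :: l, x ∈ s) (hv : v ∈ s) :
    ∃ (y : s) (p : (G.induce s).Walk ⟨v, hv⟩ y), p.IsPath ∧ p.length = l.length := by
  obtain ⟨y, p, hp⟩ := exists_walk_induce_of_isChain v l hl hs hv
  refine ⟨y, p, ?_, ?_⟩
  · rw [SimpleGraph.Walk.isPath_def]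
    exact List.Nodup.of_map Subtype.val (hp ▸ hd)
  · have := congrArg List.length hp
    simpa using this

/-- The vertex of `Q_{n+2}` over `w` with first two coordinates `a`, `b`. -/
def fiberVertex {n : ℕ} (a b : Bool) (w : Fin n → Bool) : Fin (n + 2) → Bool :=
  Fin.cons a (Fin.cons b w : Fin (n + 1) → Bool)

lemma fiberVertex_inj {n : ℕ} {a b a' b' : Bool} {w w' : Fin n → Bool} :
    fiberVertex a b w = fiberVertex a' b' w' ↔ a = a' ∧ b = b' ∧ w = w' := by
  simp [fiberVertex, Fin.cons_inj]

lemma exists_eq_fiberVertex {n : ℕ} (v : Fin (n + 2) → Bool) :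
    ∃ a b w, v = fiberVertex a b w :=
  ⟨v 0, v 1, Fin.tail (Fin.tail v), by
    rw [fiberVertex]
    conv_lhs => rw [← Fin.cons_self_tail v, ← Fin.cons_self_tail (Fin.tail v)]
    rfl⟩

lemma wt_fiberVertex {n : ℕ} (a b : Bool) (w : Fin n → Bool) :
    wt (fiberVertex a b w) =
      (if a = true then 1 else 0) + ((if b = true then 1 else 0) + wt w) := by
  rw [fiberVertex, wt_cons, wt_cons]

lemma adj_fiberVertex {n : ℕ} {a b a' b' : Bool} {w w' : Fin n → Bool} :
    (hypercube (n + 2)).Adj (fiberVertex a b w) (fiberVertex a' b' w') ↔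
      (if a ≠ a' then 1 else 0) + ((if b ≠ b' then 1 else 0) + hammingDist w w') = 1 := by
  rw [hypercube_adj, fiberVertex, fiberVertex, hammingDist_cons, hammingDist_cons]

/-- The even vertex of `Q_{n+2}` over `w` whose first coordinate is `1`. -/
def evenTop {n : ℕ} (w : Fin n → Bool) : Fin (n + 2) → Bool :=
  fiberVertex true (decide (wt w % 2 = 0)) w

lemma wt_evenTop {n : ℕ} (w : Fin n → Bool) : wt (evenTop w) % 2 = 0 := by
  rw [evenTop, wt_fiberVertex]
  simp only [decide_eq_true_eq]
  split_ifs <;> simp_all <;> omega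

lemma evenTop_injective {n : ℕ} : Function.Injective (evenTop (n := n)) :=
  fun _ _ h => (fiberVertex_inj.1 h).2.2

lemma fiberVertex_mem_image_evenTop {n : ℕ} {W : Finset (Fin n → Bool)} {a b : Bool}
    {w : Fin n → Bool} :
    fiberVertex a b w ∈ W.image evenTop ↔
      w ∈ W ∧ a = true ∧ wt (fiberVertex a b w) % 2 = 0 := by
  rw [Finset.mem_image, wt_fiberVertex]
  constructor
  · rintro ⟨x, hx, h⟩
    have h2 := wt_evenTop x
    rw [h, wt_fiberVertex] at h2
    obtain ⟨rfl, h', rfl⟩ := fiberVertex_inj.1 h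
    exact ⟨hx, rfl, h2⟩
  · rintro ⟨hw, rfl, h⟩
    refine ⟨w, hw, fiberVertex_inj.2 ⟨rfl, ?_, rfl⟩⟩
    cases b <;> simp at h ⊢ <;> omega

/-- Lift a path of `Q_n` ending in `W` to a path of `Q_{n+2}` avoiding the vertices `evenTop w`,
`w ∈ W`: fibers over `W` contribute two vertices (three for the last one), the others four. -/
lemma exists_lift_list {n : ℕ} (W : Finset (Fin n → Bool)) (L : List (Fin n → Bool))
    (w : Fin n → Bool) (hL : (w :: L).IsChain (hypercube n).Adj) (hd : (w :: L).Nodup)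
    (hlast : (w :: L).getLast (by simp) ∈ W) (a b : Bool)
    (hodd : wt (fiberVertex a b w) % 2 = 1) :
    ∃ P : List (Fin (n + 2) → Bool),
      (fiberVertex a b w :: P).IsChain (hypercube (n + 2)).Adj ∧
      (fiberVertex a b w :: P).Nodup ∧
      (∀ x ∈ fiberVertex a b w :: P, x ∉ W.image evenTop ∧
        ∃ c d, ∃ z ∈ w :: L, x = fiberVertex c d z) ∧
      P.length + 2 * ((w :: L).filter (· ∈ W)).length = 4 * (w :: L).length := by
  induction L generalizing w a b with
  | nil =>
    have hw : w ∈ W := by simpa using hlast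
    rw [wt_fiberVertex] at hodd
    refine ⟨[fiberVertex false (if a = true then b else !b) w, fiberVertex (!a) (!b) w],
      ?_, ?_, ?_, ?_⟩
    · cases a <;> cases b <;> simp [adj_fiberVertex]
    · cases a <;> cases b <;> simp [fiberVertex_inj]
    · intro x hx
      simp only [List.mem_cons, List.not_mem_nil, or_false] at hx
      rcases hx with rfl | rfl | rfl <;>
        refine ⟨?_, _, _, w, by simp, rfl⟩ <;>
        rw [fiberVertex_mem_image_evenTop, wt_fiberVertex] <;>
        cases a <;> cases b <;> simp at hodd ⊢ <;> omega
    · simp [hw]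
  | cons w' L ih =>
    rw [List.isChain_cons_cons] at hL
    rw [List.nodup_cons] at hd
    have hpar := wt_mod_two_ne_of_adj hL.1
    have hdist := hypercube_adj.1 hL.1
    have hlast' : (w' :: L).getLast (by simp) ∈ W := by simpa using hlast
    rw [wt_fiberVertex] at hodd
    by_cases hw : w ∈ W
    · obtain ⟨P, pc, pd, pm, pl⟩ := ih w' hL.2 hd.2 hlast' false (if a = true then b else !b) (by
        rw [wt_fiberVertex]
        cases a <;> cases b <;> simp at hodd ⊢ <;> omega)
      have hP : ∀ c d, fiberVertex c d w ∉
          fiberVertex false (if a = true then b else !b) w' :: P := by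
        intro c d hx
        obtain ⟨-, c', d', z, hz, h⟩ := pm _ hx
        exact hd.1 ((fiberVertex_inj.1 h).2.2 ▸ hz)
      refine ⟨fiberVertex false (if a = true then b else !b) w ::
        fiberVertex false (if a = true then b else !b) w' :: P, ?_, ?_, ?_, ?_⟩
      · rw [List.isChain_cons_cons, List.isChain_cons_cons]
        refine ⟨?_, ?_, pc⟩
        · cases a <;> cases b <;> simp [adj_fiberVertex]
        · simp [adj_fiberVertex, hdist]
      · rw [List.nodup_cons, List.nodup_cons, List.mem_cons, not_or]
        refine ⟨⟨?_, hP _ _⟩, hP _ _, pd⟩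
        cases a <;> cases b <;> simp [fiberVertex_inj]
      · intro x hx
        rw [List.mem_cons, List.mem_cons] at hx
        rcases hx with rfl | rfl | hx
        · refine ⟨?_, _, _, w, by simp, rfl⟩
          rw [fiberVertex_mem_image_evenTop, wt_fiberVertex]
          omega
        · refine ⟨?_, _, _, w, by simp, rfl⟩
          rw [fiberVertex_mem_image_evenTop]
          simp
        · obtain ⟨h, c, d, z, hz, rfl⟩ := pm x hx
          exact ⟨h, c, d, z, List.mem_cons_of_mem _ hz, rfl⟩
      · rw [List.filter_cons_of_pos (by simpa using hw)]
        simp only [List.length_cons] at pl ⊢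
        omega
    · obtain ⟨P, pc, pd, pm, pl⟩ := ih w' hL.2 hd.2 hlast' a (!b) (by
        rw [wt_fiberVertex]
        cases a <;> cases b <;> simp at hodd ⊢ <;> omega)
      have hP : ∀ c d, fiberVertex c d w ∉ fiberVertex a (!b) w' :: P := by
        intro c d hx
        obtain ⟨-, c', d', z, hz, h⟩ := pm _ hx
        exact hd.1 ((fiberVertex_inj.1 h).2.2 ▸ hz)
      refine ⟨fiberVertex (!a) b w :: fiberVertex (!a) (!b) w :: fiberVertex a (!b) w ::
        fiberVertex a (!b) w' :: P, ?_, ?_, ?_, ?_⟩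
      · rw [List.isChain_cons_cons, List.isChain_cons_cons, List.isChain_cons_cons,
          List.isChain_cons_cons]
        refine ⟨?_, ?_, ?_, ?_, pc⟩ <;> simp [adj_fiberVertex, hdist]
      · rw [List.nodup_cons, List.nodup_cons, List.nodup_cons, List.nodup_cons]
        refine ⟨?_, ?_, ?_, hP _ _, pd⟩ <;>
          simp only [List.mem_cons (b := fiberVertex _ _ w), hP, or_false] <;>
          simp [fiberVertex_inj]
      · have hC : ∀ c d, fiberVertex c d w ∉ W.image evenTop := fun c d h =>
          hw (fiberVertex_mem_image_evenTop.1 h).1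
        intro x hx
        rw [List.mem_cons, List.mem_cons, List.mem_cons, List.mem_cons] at hx
        rcases hx with rfl | rfl | rfl | rfl | hx
        iterate 4 exact ⟨hC _ _, _, _, w, by simp, rfl⟩
        obtain ⟨h, c, d, z, hz, rfl⟩ := pm x hx
        exact ⟨h, c, d, z, List.mem_cons_of_mem _ hz, rfl⟩
      · rw [List.filter_cons_of_neg (by simpa using hw)]
        simp only [List.length_cons] at pl ⊢
        omega

/-- for `j ≤ 2^(k-2)` there is a set `C` of exactly `j` even-weight
vertices of `Q_k` such that from every odd-weight vertex `v`, the graph `Q_k - C`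
contains a path of length `2^k - 2j` starting at `v`. -/
theorem stmt14 (k j : ℕ) (hk : 2 ≤ k) (hj0 : 0 < j) (hj : j ≤ 2 ^ (k - 2)) :
    ∃ C : Finset (Fin k → Bool), C.card = j ∧ (∀ v ∈ C, wt v % 2 = 0) ∧
      ∀ (v : Fin k → Bool), wt v % 2 = 1 → ∀ hv : v ∉ C,
        ∃ (y : {u : Fin k → Bool // u ∉ C})
          (p : ((hypercube k).induce {u : Fin k → Bool | u ∉ C}).Walk ⟨v, hv⟩ y),
          p.IsPath ∧ p.length = 2 ^ k - 2 * j := by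
  obtain ⟨n, rfl⟩ : ∃ n, k = n + 2 := ⟨k - 2, by omega⟩
  rw [Nat.add_sub_cancel] at hj
  rcases Nat.lt_or_ge 1 j with hj1 | hj1
  · obtain ⟨W, hW, hWj⟩ : ∃ W : Finset (Fin n → Bool),
        (∀ w : Fin n → Bool, ∃ z ∈ W, wt w % 2 ≠ wt z % 2) ∧ W.card = j := by
      cases n with
      | zero => simp at hj; omega
      | succ m =>
        let o : Fin m → Bool := fun _ => false
        obtain ⟨W, hsub, -, hcard⟩ := Finset.exists_subsuperset_card_eq
          (Finset.subset_univ ({Fin.cons false o, Fin.cons true o} : Finset (Fin (m + 1) → Bool)))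
          (n := j) (Finset.card_le_two.trans hj1) (by simpa using hj)
        refine ⟨W, fun w => ?_, hcard⟩
        have h0 := wt_cons false o
        have h1 := wt_cons true o
        simp only [Bool.false_eq_true, if_false, if_true] at h0 h1
        by_cases h : wt w % 2 = wt (Fin.cons false o : Fin (m + 1) → Bool) % 2
        · exact ⟨Fin.cons true o, hsub (by simp), by omega⟩
        · exact ⟨Fin.cons false o, hsub (by simp), h⟩
    refine ⟨W.image evenTop, ?_, ?_, ?_⟩
    · rw [Finset.card_image_of_injective _ evenTop_injective, hWj]
    · intro v hv
      obtain ⟨w, -, rfl⟩ := Finset.mem_image.1 hv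
      exact wt_evenTop w
    · intro v hodd hv
      obtain ⟨a, b, w, rfl⟩ := exists_eq_fiberVertex v
      obtain ⟨z, hz, hwz⟩ := hW w
      obtain ⟨L, hc, hd, hm, hs, ht⟩ := exists_hamiltonian_list w z hwz
      obtain ⟨L, rfl⟩ := List.head?_eq_some_iff.1 hs
      rw [List.getLast?_eq_some_getLast (by simp), Option.some_inj] at ht
      obtain ⟨P, pc, pd, pm, pl⟩ := exists_lift_list W L w hc hd (ht ▸ hz) a b hodd
      obtain ⟨y, p, hp, hlen⟩ := exists_isPath_induce_of_isChain
        (s := {u | u ∉ W.image evenTop}) _ P pc pd (fun x hx => (pm x hx).1) hv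
      refine ⟨y, p, hp, ?_⟩
      have e1 : (w :: L).length = 2 ^ n := by
        rw [← List.toFinset_card_of_nodup hd,
          Finset.eq_univ_iff_forall.2 fun x => List.mem_toFinset.2 (hm x)]
        simp
      have e2 : ((w :: L).filter (· ∈ W)).length = j := by
        rw [← List.toFinset_card_of_nodup (hd.filter _), ← hWj]
        congr 1
        ext x
        simpa using fun _ => hm x
      rw [hlen, pow_add]
      omega
  · obtain rfl : j = 1 := by omega
    let o : Fin (n + 2) → Bool := fun _ => false
    have ho : wt o % 2 = 0 := by simp [wt, o]
    refine ⟨{o}, by simp, by simpa using ho, fun v hodd hv => ?_⟩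
    obtain ⟨L, hc, hd, hm, hs, ht⟩ := exists_hamiltonian_list v o (by omega)
    obtain ⟨L, rfl⟩ := List.getLast?_eq_some_iff.1 ht
    have hlen : (L ++ [o]).length = 2 ^ (n + 2) := by
      rw [← List.toFinset_card_of_nodup hd,
        Finset.eq_univ_iff_forall.2 fun x => List.mem_toFinset.2 (hm x)]
      simp
    obtain ⟨P, rfl⟩ : ∃ P, L = v :: P := by
      cases L with
      | nil => simp at hs hv; exact absurd hs.symm hv
      | cons x P => exact ⟨P, by simpa using hs⟩
    rw [List.nodup_append] at hd
    obtain ⟨y, p, hp, hpl⟩ := exists_isPath_induce_of_isChain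
      (s := {u | u ∉ ({o} : Finset (Fin (n + 2) → Bool))}) v P hc.left_of_append hd.1
      (fun x hx => by simpa using hd.2.2 x hx o (by simp)) hv
    refine ⟨y, p, hp, ?_⟩
    simp only [List.length_append, List.length_cons, List.length_nil] at hlen
    omega
end

section
/- For all integers k_1, k_2, k_3, k_4 ≥ 3, for all sufficiently large n, sat(Q_n, S_{k_1×k_2×k_3×k_4}) ≤ min(k_1, k_2, k_3, k_4) · 2^(n−1). -/
open SimpleGraph

/-- Number of spine-neighbors of the `i`-th spine vertex (0-based) of a
caterpillar with `m` spine vertices. -/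
def spineExtra (m i : ℕ) : ℕ := (if i = 0 then 0 else 1) + (if i = m - 1 then 0 else 1)

/-- The caterpillar `S_{k 0 × k 1 × ⋯ × k (m-1)}`: the vertices of degree `> 1`
form a path of `m` vertices (the spine) whose `i`-th vertex has degree `k i`;
all other vertices are leaves attached to the spine. -/
def caterpillar (m : ℕ) (k : ℕ → ℕ) :
    SimpleGraph (Fin m ⊕ Σ i : Fin m, Fin (k (i : ℕ) - spineExtra m (i : ℕ))) :=
  SimpleGraph.fromRel (fun u v =>
    match u, v with
    | Sum.inl a, Sum.inl b => (a : ℕ) + 1 = (b : ℕ)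
    | Sum.inl a, Sum.inr p => a = p.1
    | _, _ => False)

/-- Every spine vertex of a four-spine caterpillar has at least its prescribed degree. -/
theorem le_ncard_neighborSet_caterpillar (k : ℕ → ℕ) (hk : ∀ i : Fin 4, 3 ≤ k i) (i : Fin 4) :
    k i ≤ ((caterpillar 4 k).neighborSet (Sum.inl i)).ncard := by
  classical
  let leaves : Finset (Fin 4 ⊕ Σ i : Fin 4, Fin (k (i : ℕ) - spineExtra 4 (i : ℕ))) :=
    (Finset.univ : Finset (Fin (k (i : ℕ) - spineExtra 4 (i : ℕ)))).image
      fun l => Sum.inr ⟨i, l⟩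
  let spine : Finset (Fin 4 ⊕ Σ i : Fin 4, Fin (k (i : ℕ) - spineExtra 4 (i : ℕ))) :=
    (Finset.univ.filter fun b : Fin 4 => (i : ℕ) + 1 = b ∨ (b : ℕ) + 1 = i).image Sum.inl
  have hleaves : leaves.card = k i - spineExtra 4 i := by
    rw [Finset.card_image_of_injective, Finset.card_univ, Fintype.card_fin]
    intro a b hab
    simpa using hab
  have hspine : spine.card = spineExtra 4 i := by
    rw [Finset.card_image_of_injective _ Sum.inl_injective]
    fin_cases i <;> decide
  have hdisj : Disjoint leaves spine := by
    rw [Finset.disjoint_left]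
    intro a ha hb
    simp only [leaves, spine, Finset.mem_image] at ha hb
    obtain ⟨_, _, rfl⟩ := ha
    obtain ⟨_, _, h⟩ := hb
    cases h
  have hle : spineExtra 4 i ≤ 2 := by
    fin_cases i <;> decide
  have hsub : (↑(leaves ∪ spine) : Set _) ⊆ (caterpillar 4 k).neighborSet (Sum.inl i) := by
    intro a ha
    simp only [leaves, spine, Finset.coe_union, Finset.coe_image, Set.mem_union, Set.mem_image,
      Finset.coe_univ, Set.mem_univ, true_and, Finset.coe_filter, Finset.mem_univ,
      Set.mem_ofPred_eq] at ha
    rcases ha with ⟨l, rfl⟩ | ⟨b, hb, rfl⟩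
    · simp [caterpillar]
    · simp only [mem_neighborSet, caterpillar, SimpleGraph.fromRel_adj]
      refine ⟨?_, hb⟩
      intro h
      have := Sum.inl_injective h
      subst this
      omega
  have := Set.ncard_le_ncard hsub (Set.toFinite _)
  rw [Set.ncard_coe_finset, Finset.card_union_of_disjoint hdisj, hleaves, hspine] at this
  have := hk i
  omega

/-- A path of spine vertices extends to a caterpillar if all but one of its vertices have large
degree, and the remaining one has enough neighbours off the path. -/
theorem hasCopy_caterpillar {V : Type*} [Finite V] (H : SimpleGraph V) (m : ℕ) (k : ℕ → ℕ)
    (x : Fin m → V) (hx : Function.Injective x)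
    (hadj : ∀ a b : Fin m, (a : ℕ) + 1 = b → H.Adj (x a) (x b)) (K : ℕ)
    (hK : Fintype.card (Σ i : Fin m, Fin (k (i : ℕ) - spineExtra m (i : ℕ))) + m ≤ K)
    (j : Fin m) (hj : k j - spineExtra m j ≤ (H.neighborSet (x j) \ Set.range x).ncard)
    (hi : ∀ i, i ≠ j → K ≤ (H.neighborSet (x i)).ncard) :
    HasCopy H (caterpillar m k) := by
  classical
  have := Fintype.ofFinite V
  let t : (Σ i : Fin m, Fin (k (i : ℕ) - spineExtra m (i : ℕ))) → Finset V :=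
    fun p => (H.neighborSet (x p.1) \ Set.range x).toFinset
  have hall : ∀ s : Finset (Σ i : Fin m, Fin (k (i : ℕ) - spineExtra m (i : ℕ))),
      s.card ≤ (s.biUnion t).card := by
    intro s
    have hcard : ∀ p, (t p).card = (H.neighborSet (x p.1) \ Set.range x).ncard := fun p =>
      (Set.ncard_eq_toFinset_card' _).symm
    by_cases h : ∃ p ∈ s, p.1 ≠ j
    · obtain ⟨p, hp, hpj⟩ := h
      have h1 := Finset.card_le_card (Finset.subset_biUnion_of_mem t hp)
      have h2 := hi p.1 hpj
      have h3 := Set.le_ncard_sdiff (Set.range x) (H.neighborSet (x p.1))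
      have h4 : (Set.range x).ncard = m := by
        rw [← Set.image_univ, Set.ncard_image_of_injective _ hx, Set.ncard_univ, Nat.card_fin]
      have h5 := Finset.card_le_univ s
      have h6 := hcard p
      omega
    · push Not at h
      rcases s.eq_empty_or_nonempty with rfl | ⟨p, hp⟩
      · simp
      have h1 := Finset.card_le_card (Finset.subset_biUnion_of_mem t hp)
      have h6 := hcard p
      have h2 : s ⊆ (Finset.univ : Finset (Fin (k (j : ℕ) - spineExtra m (j : ℕ)))).image
          (fun l => ⟨j, l⟩) := by
        rintro ⟨i, l⟩ hq
        obtain rfl : i = j := h _ hq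
        simp
      have h3 := (Finset.card_le_card h2).trans Finset.card_image_le
      rw [Finset.card_univ, Fintype.card_fin] at h3
      rw [h p hp] at h6
      omega
  obtain ⟨f, hf, hft⟩ := (Finset.all_card_le_biUnion_card_iff_exists_injective t).1 hall
  have hft' : ∀ p, H.Adj (x p.1) (f p) ∧ ∀ i, x i ≠ f p := by
    intro p
    have := hft p
    simpa [t] using this
  refine ⟨⟨Sum.elim x f, ?_⟩, ?_⟩
  · rintro (a | p) (b | q) h <;> simp only [caterpillar, SimpleGraph.fromRel_adj] at h <;>
      simp only [Sum.elim_inl, Sum.elim_inr]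
    · rcases h.2 with h | h
      · exact hadj _ _ h
      · exact (hadj _ _ h).symm
    · rcases h.2 with h | h
      · subst h; exact (hft' q).1
      · exact h.elim
    · rcases h.2 with h | h
      · exact h.elim
      · subst h; exact (hft' p).1.symm
    · exact (h.2.elim id id).elim
  · rintro (a | p) (b | q) h
    · exact congrArg _ (hx h)
    · exact ((hft' q).2 _ h).elim
    · exact ((hft' p).2 _ h.symm).elim
    · exact congrArg _ (hf h)

theorem injective_vec_four {V : Type*} {a b c d : V} (hab : a ≠ b) (hac : a ≠ c) (had : a ≠ d)
    (hbc : b ≠ c) (hbd : b ≠ d) (hcd : c ≠ d) : Function.Injective ![a, b, c, d] := by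
  intro i j hij
  fin_cases i <;> fin_cases j <;> simp_all [eq_comm]

/-- A sufficient criterion for saturation with respect to a four-spine caterpillar. The vertices
split into low vertices `A` and hubs `W` on one side, and low vertices `B` and hubs `D` on the
other. Low vertices have degree less than all spine degrees, and the graph between the hubs is a
union of stars centred in `W`. -/
theorem isSat_caterpillar {V : Type*} [Finite V] (Host H : SimpleGraph V) (hle : H ≤ Host)
    (k : ℕ → ℕ) (hk : ∀ i : Fin 4, 3 ≤ k i) (j : Fin 4) (hmin : ∀ i : Fin 4, k j ≤ k i)
    (K : ℕ) (hKk : k j + 2 < K)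
    (hK : Fintype.card (Σ i : Fin 4, Fin (k (i : ℕ) - spineExtra 4 (i : ℕ))) + 4 ≤ K)
    (E S : Set V)
    (hHost : ∀ u v, Host.Adj u v → (u ∈ E ↔ v ∉ E))
    (degA : ∀ u ∈ E, u ∉ S → (H.neighborSet u).ncard = k j - 1)
    (degB : ∀ u ∉ E, u ∉ S → (H.neighborSet u).ncard ≤ k j - 1)
    (hWB : ∀ w ∈ E, w ∈ S → ∀ b ∉ S, Host.Adj w b → H.Adj w b)
    (hDW : ∀ d ∉ E, d ∈ S → ∃ w ∈ S, H.Adj d w)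
    (hDW_unique : ∀ d ∉ E, d ∈ S → ∀ w ∈ S, ∀ w' ∈ S, H.Adj d w → H.Adj d w' → w = w')
    (degW : ∀ w ∈ E, w ∈ S → K ≤ (H.neighborSet w ∩ S).ncard)
    (degD : ∀ d ∉ E, d ∈ S → K ≤ (H.neighborSet d).ncard)
    (hAD : ∀ u ∈ E, u ∉ S → ∃ d ∈ S, ∃ d' ∈ S, d ≠ d' ∧ H.Adj u d ∧ H.Adj u d') :
    IsSat Host H (caterpillar 4 k) := by
  classical
  have hE : ∀ {u v}, H.Adj u v → (u ∈ E ↔ v ∉ E) := fun h => hHost _ _ (hle h)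
  have degS : ∀ v ∈ S, K ≤ (H.neighborSet v).ncard := by
    intro v hv
    by_cases h : v ∈ E
    · exact (degW v h hv).trans (Set.ncard_le_ncard Set.inter_subset_left (Set.toFinite _))
    · exact degD v h hv
  refine ⟨hle, ?_, ?_⟩
  · rintro ⟨f, hf⟩
    have hS : ∀ i, f (Sum.inl i) ∈ S := by
      intro i
      by_contra hS
      have h1 := le_ncard_neighborSet_caterpillar k hk i
      have h2 : ((caterpillar 4 k).neighborSet (Sum.inl i)).ncard ≤
          (H.neighborSet (f (Sum.inl i))).ncard := by
        rw [← Set.ncard_image_of_injective _ hf]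
        refine Set.ncard_le_ncard ?_ (Set.toFinite _)
        rintro _ ⟨a, ha, rfl⟩
        exact f.map_adj ha
      have h3 : (H.neighborSet (f (Sum.inl i))).ncard ≤ k j - 1 := by
        by_cases h : f (Sum.inl i) ∈ E
        · exact (degA _ h hS).le
        · exact degB _ h hS
      have h4 := hmin i
      have h5 := hk j
      omega
    have hpath : ∀ a b : Fin 4, (a : ℕ) + 1 = b → H.Adj (f (Sum.inl a)) (f (Sum.inl b)) := by
      intro a b hab
      refine f.map_adj ?_
      simp only [caterpillar, SimpleGraph.fromRel_adj]
      refine ⟨fun h => ?_, Or.inl hab⟩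
      have := Sum.inl_injective h
      subst this
      omega
    have h01 := hpath 0 1 rfl
    have h12 := hpath 1 2 rfl
    have h23 := hpath 2 3 rfl
    by_cases h1 : f (Sum.inl 1) ∈ E
    · have h2 := (hE h12).1 h1
      have := hf (hDW_unique _ h2 (hS 2) _ (hS 1) _ (hS 3) h12.symm h23)
      simp at this
    · have := hf (hDW_unique _ h1 (hS 1) _ (hS 0) _ (hS 2) h01.symm h12)
      simp at this
  · have key : ∀ u v, u ∈ E → Host.Adj u v → ¬ H.Adj u v →
        HasCopy (H ⊔ SimpleGraph.fromEdgeSet {s(u, v)}) (caterpillar 4 k) := by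
      intro u v hu huv hn
      set H' := H ⊔ SimpleGraph.fromEdgeSet {s(u, v)} with hH'
      have hHH' : H ≤ H' := le_sup_left
      have hnew : H'.Adj u v := by
        right
        simp [huv.ne]
      have hv : v ∉ E := (hHost _ _ huv).1 hu
      have hE' : ∀ {a b}, H'.Adj a b → (a ∈ E ↔ b ∉ E) := by
        intro a b hab
        rcases hab with hab | hab
        · exact hE hab
        · simp only [fromEdgeSet_adj, Set.mem_singleton_iff, Sym2.eq_iff] at hab
          rcases hab.1 with ⟨rfl, rfl⟩ | ⟨rfl, rfl⟩ <;> tauto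
      have degS' : ∀ v ∈ S, K ≤ (H'.neighborSet v).ncard := fun a ha =>
        (degS a ha).trans (Set.ncard_le_ncard (fun b hb => hHH' hb) (Set.toFinite _))
      have copy : ∀ (x : Fin 4 → V), Function.Injective x → H'.Adj (x 0) (x 1) →
          H'.Adj (x 1) (x 2) → H'.Adj (x 2) (x 3) → ∀ l : Fin 4,
          (∀ i, i ≠ l → x i ∈ S) →
          k l - spineExtra 4 l ≤ (H'.neighborSet (x l) \ Set.range x).ncard →
          HasCopy H' (caterpillar 4 k) := by
        intro x hx h01 h12 h23 l hl hc
        refine hasCopy_caterpillar H' 4 k x hx ?_ K hK l hc fun i hi => degS' _ (hl i hi)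
        intro a b hab
        fin_cases a <;> fin_cases b <;> simp at hab <;> assumption
      have ne : ∀ {a b}, a ∈ E → b ∉ E → a ≠ b := by
        rintro a b ha hb rfl; exact hb ha
      by_cases huS : u ∈ S
      · have hvS : v ∈ S := by
          by_contra h
          exact hn (hWB u hu huS v h huv)
        obtain ⟨w, hw, hvw⟩ := hDW v hv hvS
        have hwE : w ∈ E := by
          have := hE hvw
          tauto
        obtain ⟨d, hd⟩ : (H.neighborSet u ∩ S).Nonempty := by
          apply Set.nonempty_of_ncard_ne_zero
          have := degW u hu huS
          omega
        have hdE : d ∉ E := (hE hd.1).1 hu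
        have hdv : d ≠ v := by rintro rfl; exact hn hd.1
        have huw : u ≠ w := by rintro rfl; exact hn hvw.symm
        have hx := injective_vec_four (ne hu hdE).symm hdv (ne hwE hdE).symm (ne hu hv) huw
          (ne hwE hv).symm
        refine copy ![d, u, v, w] hx (hHH' hd.1.symm) hnew (hHH' hvw) 0 ?_ ?_
        · intro i hi
          fin_cases i
          exacts [hd.2, huS, hvS, hw]
        · have h1 := Set.le_ncard_sdiff (Set.range ![d, u, v, w]) (H'.neighborSet d)
          have h2 := degS' d hd.2
          have h3 : (Set.range ![d, u, v, w]).ncard = 4 := by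
            rw [← Set.image_univ, Set.ncard_image_of_injective _ hx, Set.ncard_univ, Nat.card_fin]
          have h4 := Fintype.card_le_of_injective
            (fun a : Fin (k (0 : Fin 4) - spineExtra 4 (0 : Fin 4)) =>
              (⟨0, a⟩ : Σ i : Fin 4, Fin (k (i : ℕ) - spineExtra 4 (i : ℕ))))
            (fun a b hab => by simpa using hab)
          rw [Fintype.card_fin] at h4
          change _ ≤ (H'.neighborSet d \ _).ncard
          omega
      · have degu : (H'.neighborSet u).ncard = k j := by
          have : H'.neighborSet u = insert v (H.neighborSet u) := by
            ext a
            simp only [hH', mem_neighborSet, sup_adj, fromEdgeSet_adj, Set.mem_singleton_iff,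
              Sym2.eq_iff, Set.mem_insert_iff]
            constructor
            · rintro (h | ⟨⟨_, h⟩ | ⟨h, h'⟩, _⟩)
              · exact Or.inr h
              · exact Or.inl h
              · exact Or.inl (h'.trans h)
            · rintro (rfl | h)
              · exact Or.inr ⟨Or.inl (by simp), huv.ne⟩
              · exact Or.inl h
          have hvN : v ∉ H.neighborSet u := hn
          rw [this, Set.ncard_insert_of_notMem hvN (Set.toFinite _), degA u hu huS]
          have := hk j
          omega
        obtain ⟨d, hd, d', hd', hdd, hud, hud'⟩ := hAD u hu huS
        have hdE := (hE hud).1 hu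
        have hdE' := (hE hud').1 hu
        obtain ⟨w, hw, hdw⟩ := hDW d hdE hd
        have hwE : w ∈ E := by
          have := hE hdw
          tauto
        have hwu : w ≠ u := by rintro rfl; exact huS hw
        have offPath : ∀ x : Fin 4 → V, ∀ l, x l = u → ∀ F : Finset V, F.card = spineExtra 4 l →
            (∀ i, H'.Adj u (x i) → x i ∈ F) →
            k j - spineExtra 4 l ≤ (H'.neighborSet (x l) \ Set.range x).ncard := by
          intro x l hl F hF hsub
          have h1 := Set.le_ncard_sdiff (F : Set V) (H'.neighborSet u)
          rw [Set.ncard_coe_finset, hF, degu] at h1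
          rw [hl]
          refine h1.trans (Set.ncard_le_ncard ?_ (Set.toFinite _))
          rintro a ⟨ha, haF⟩
          refine ⟨ha, ?_⟩
          rintro ⟨i, rfl⟩
          exact haF (hsub i ha)
        have notAdj : ∀ {a}, a ∈ E → ¬ H'.Adj u a := fun ha h => (hE' h).1 hu ha
        obtain ⟨d'', hd'', hnd⟩ : ((H.neighborSet w ∩ S) \ H'.neighborSet u).Nonempty := by
          apply Set.nonempty_of_ncard_ne_zero
          have := Set.le_ncard_sdiff (H'.neighborSet u) (H.neighborSet w ∩ S)
          have := degW w hwE hw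
          omega
        have hdE'' : d'' ∉ E := (hE hd''.1).1 hwE
        have hdd'' : d'' ≠ d := by rintro rfl; exact hnd (hHH' hud)
        have hud'' : ¬ H'.Adj u d'' := hnd
        have hwd'' : H.Adj w d'' := hd''.1
        fin_cases j
        · refine copy ![u, d, w, d''] (injective_vec_four (ne hu hdE) hwu.symm (ne hu hdE'')
            (ne hwE hdE).symm hdd''.symm (ne hwE hdE'')) (hHH' hud) (hHH' hdw) (hHH' hwd'') 0
            ?_ (offPath _ 0 rfl {d} rfl ?_)
          · intro i hi
            fin_cases i
            exacts [absurd rfl hi, hd, hw, hd''.2]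
          · intro i hi
            fin_cases i
            exacts [absurd rfl hi.ne, Finset.mem_singleton_self _, absurd hi (notAdj hwE),
              absurd hi hud'']
        · refine copy ![d', u, d, w] (injective_vec_four (ne hu hdE').symm hdd.symm (ne hwE hdE').symm
            (ne hu hdE) hwu.symm (ne hwE hdE).symm) (hHH' hud'.symm) (hHH' hud) (hHH' hdw) 1
            ?_ (offPath _ 1 rfl {d, d'} (Finset.card_pair hdd) ?_)
          · intro i hi
            fin_cases i
            exacts [hd', absurd rfl hi, hd, hw]
          · intro i hi
            fin_cases i
            · simp
            · exact absurd rfl hi.ne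
            · simp
            · exact absurd hi (notAdj hwE)
        · refine copy ![w, d, u, d'] (injective_vec_four (ne hwE hdE) hwu (ne hwE hdE')
            (ne hu hdE).symm hdd (ne hu hdE')) (hHH' hdw.symm) (hHH' hud.symm) (hHH' hud') 2
            ?_ (offPath _ 2 rfl {d, d'} (Finset.card_pair hdd) ?_)
          · intro i hi
            fin_cases i
            exacts [hw, hd, absurd rfl hi, hd']
          · intro i hi
            fin_cases i
            · exact absurd hi (notAdj hwE)
            · simp
            · exact absurd rfl hi.ne
            · simp
        · refine copy ![d'', w, d, u] (injective_vec_four (ne hwE hdE'').symm hdd'' (ne hu hdE'').symm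
            (ne hwE hdE) hwu (ne hu hdE).symm) (hHH' hwd''.symm) (hHH' hdw.symm) (hHH' hud.symm) 3
            ?_ (offPath _ 3 rfl {d} rfl ?_)
          · intro i hi
            fin_cases i
            exacts [hd''.2, hw, hd, absurd rfl hi]
          · intro i hi
            fin_cases i
            exacts [absurd hi hud'', absurd hi (notAdj hwE), Finset.mem_singleton_self _,
              absurd rfl hi.ne]
    intro u v huv hn
    by_cases hu : u ∈ E
    · exact key u v hu huv hn
    · have hv : v ∈ E := by
        have := hHost _ _ huv
        tauto
      rw [Sym2.eq_swap]
      exact key v u hv huv.symm fun h => hn h.symm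

/-- The vertex of the cube obtained by flipping the `i`-th coordinate. -/
def flipAt {n : ℕ} (v : Fin n → Bool) (i : Fin n) : Fin n → Bool :=
  Function.update v i (!v i)

theorem flipAt_flipAt {n : ℕ} (v : Fin n → Bool) (i : Fin n) : flipAt (flipAt v i) i = v := by
  simp [flipAt]

theorem flipAt_left_injective {n : ℕ} (i : Fin n) :
    Function.Injective fun v : Fin n → Bool => flipAt v i :=
  Function.LeftInverse.injective (g := fun v => flipAt v i) fun v => flipAt_flipAt v i

theorem flipAt_injective {n : ℕ} (v : Fin n → Bool) : Function.Injective (flipAt v) := by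
  intro i j h
  by_contra hij
  have := congrFun h i
  simp [flipAt, Function.update_of_ne hij] at this

theorem hypercube_adj_iff {n : ℕ} (u v : Fin n → Bool) :
    (hypercube n).Adj u v ↔ ∃ i, v = flipAt u i := by
  rw [hypercube, SimpleGraph.fromRel_adj, hammingDist_comm v u, or_self]
  constructor
  · rintro ⟨-, h⟩
    obtain ⟨i, hi⟩ := Finset.card_eq_one.1 h
    refine ⟨i, funext fun j => ?_⟩
    have hj := Finset.ext_iff.1 hi j
    simp only [Finset.mem_filter, Finset.mem_univ, true_and, Finset.mem_singleton] at hj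
    by_cases hji : j = i
    · subst hji
      have := hj.2 rfl
      simp only [flipAt, Function.update_self]
      cases h1 : u j <;> cases h2 : v j <;> simp_all
    · rw [flipAt, Function.update_of_ne hji]
      by_contra h'
      exact hji (hj.1 (Ne.symm h'))
  · rintro ⟨i, rfl⟩
    have hi : ∀ j, u j ≠ flipAt u i j ↔ j = i := by
      intro j
      by_cases hji : j = i
      · subst hji; simp [flipAt]
      · simp [flipAt, hji]
    refine ⟨fun h => (hi i).2 rfl (congrFun h i), Finset.card_eq_one.2 ⟨i, ?_⟩⟩
    ext j
    simp [hi]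

/-- The sum of the labels of the coordinates at which `v` is `true`. -/
def vertexLabel {n : ℕ} {M : Type*} [AddCommMonoid M] (g : Fin n → M) (v : Fin n → Bool) : M :=
  ∑ i, if v i then g i else 0

theorem vertexLabel_flipAt {n : ℕ} {M : Type*} [AddCommMonoid M] (h2 : ∀ x : M, x + x = 0)
    (g : Fin n → M) (v : Fin n → Bool) (i : Fin n) :
    vertexLabel g (flipAt v i) = vertexLabel g v + g i := by
  unfold vertexLabel
  rw [← Finset.add_sum_erase _ _ (Finset.mem_univ i),
    ← Finset.add_sum_erase _ (fun j => if v j then g j else 0) (Finset.mem_univ i)]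
  have : ∑ j ∈ Finset.univ.erase i, (if flipAt v i j then g j else 0) =
      ∑ j ∈ Finset.univ.erase i, if v j then g j else 0 := by
    refine Finset.sum_congr rfl fun j hj => ?_
    rw [flipAt, Function.update_of_ne (Finset.ne_of_mem_erase hj)]
  rw [this]
  cases h : v i
  · simp [flipAt, h, add_comm]
  · simp only [flipAt, h, Function.update_self, Bool.not_true, Bool.false_eq_true, if_false,
      if_true, zero_add]
    rw [add_right_comm, h2, zero_add]

/-- The coordinates of the cube: two for each element of `S`, another one for each element of `S`,
`l` further coordinates joining low vertices, and `r` unused ones. -/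
abbrev Coord (S : Type) (l r : ℕ) : Type := (S × Bool) ⊕ (S ⊕ (Fin l ⊕ Fin r))

section Construction

variable {S : Type} {l r n : ℕ}

theorem flipAt_symm_injective (e : Fin n ≃ Coord S l r) (u : Fin n → Bool) :
    Function.Injective fun c => flipAt u (e.symm c) :=
  (flipAt_injective u).comp e.symm.injective

/-- The active coordinates of a low even vertex whose label has first component `σ`. -/
def lowCoords (l r : ℕ) (σ : S) : Set (Coord S l r) :=
  {Sum.inl (σ, false), Sum.inl (σ, true)} ∪ Set.range fun a => Sum.inr (Sum.inr (Sum.inl a))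

theorem ncard_lowCoords [Finite S] (σ : S) : (lowCoords l r σ).ncard = 2 + l := by
  rw [lowCoords, Set.ncard_union_eq _ (Set.toFinite _) (Set.toFinite _),
    Set.ncard_pair (by simp), ← Set.image_univ, Set.ncard_image_of_injective, Set.ncard_univ,
    Nat.card_fin]
  · intro a b h
    simpa using h
  · rw [Set.disjoint_left]
    rintro _ (rfl | rfl) ⟨a, h⟩ <;> cases h

variable [AddCommGroup S]

/-- The label of a coordinate; the first component counts parity. -/
def coordLabel : Coord S l r → ZMod 2 × (S × S)
  | Sum.inl (σ, _) => (1, σ, 0)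
  | Sum.inr (Sum.inl τ) => (1, 0, τ)
  | Sum.inr (Sum.inr _) => (1, 0, 0)

/-- The coordinates along which an even vertex with label `x` has an edge. -/
def Active (x : S × S) : Coord S l r → Prop
  | Sum.inl (σ, _) => x = 0 ∧ σ ≠ 0 ∨ x ≠ 0 ∧ σ = x.1
  | Sum.inr (Sum.inl _) => x = 0
  | Sum.inr (Sum.inr (Sum.inl _)) => x ≠ 0
  | Sum.inr (Sum.inr (Sum.inr _)) => False

/-- The label of a vertex of the cube with coordinates indexed by `Coord S l r`. -/
def cubeLabel (e : Fin n ≃ Coord S l r) (v : Fin n → Bool) : ZMod 2 × (S × S) :=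
  vertexLabel (fun i => coordLabel (e i)) v

/-- The vertices of even parity. -/
def evenVertices (e : Fin n ≃ Coord S l r) : Set (Fin n → Bool) :=
  {v | (cubeLabel e v).1 = 0}

/-- The vertices of large degree. -/
def hubs (e : Fin n ≃ Coord S l r) : Set (Fin n → Bool) :=
  {v | (cubeLabel e v).2.1 = 0 ∧ ((cubeLabel e v).1 = 0 → (cubeLabel e v).2.2 = 0)}

/-- The saturated subgraph of the cube. -/
def starCube (e : Fin n ≃ Coord S l r) : SimpleGraph (Fin n → Bool) where
  Adj u v := ∃ i, v = flipAt u i ∧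
    (u ∈ evenVertices e ∧ Active (cubeLabel e u).2 (e i) ∨
      v ∈ evenVertices e ∧ Active (cubeLabel e v).2 (e i))
  symm := ⟨by
    rintro u v ⟨i, rfl, h⟩
    exact ⟨i, (flipAt_flipAt u i).symm, h.symm⟩⟩
  loopless := ⟨by
    rintro u ⟨i, h, -⟩
    have := congrFun h i
    simp [flipAt] at this⟩

theorem coordLabel_fst (c : Coord S l r) : (coordLabel c).1 = 1 := by
  rcases c with ⟨_, _⟩ | _ | _ <;> rfl

theorem starCube_le (e : Fin n ≃ Coord S l r) : starCube e ≤ hypercube n := by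
  rintro u v ⟨i, h, -⟩
  exact (hypercube_adj_iff u v).2 ⟨i, h⟩

theorem cubeLabel_flipAt (h2 : ∀ x : S, x + x = 0) (e : Fin n ≃ Coord S l r) (v : Fin n → Bool)
    (i : Fin n) : cubeLabel e (flipAt v i) = cubeLabel e v + coordLabel (e i) := by
  refine vertexLabel_flipAt ?_ _ v i
  rintro ⟨a, b, c⟩
  simp only [Prod.mk_add_mk, h2, Prod.mk_eq_zero, and_true]
  exact CharTwo.add_self_eq_zero a

theorem flipAt_mem_evenVertices (h2 : ∀ x : S, x + x = 0) (e : Fin n ≃ Coord S l r)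
    (v : Fin n → Bool) (i : Fin n) : flipAt v i ∈ evenVertices e ↔ v ∉ evenVertices e := by
  simp only [evenVertices, Set.mem_ofPred_eq, cubeLabel_flipAt h2, Prod.fst_add, coordLabel_fst]
  generalize (cubeLabel e v).1 = a
  revert a
  decide

theorem neighborSet_even (h2 : ∀ x : S, x + x = 0) (e : Fin n ≃ Coord S l r) {u : Fin n → Bool}
    (hu : u ∈ evenVertices e) : (starCube e).neighborSet u =
      (fun c => flipAt u (e.symm c)) '' {c | Active (cubeLabel e u).2 c} := by
  ext v
  simp only [mem_neighborSet, starCube, Set.mem_image, Set.mem_ofPred_eq]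
  constructor
  · rintro ⟨i, rfl, ⟨-, h⟩ | ⟨h, -⟩⟩
    · exact ⟨e i, h, by simp⟩
    · exact absurd hu ((flipAt_mem_evenVertices h2 e u i).1 h)
  · rintro ⟨c, hc, rfl⟩
    exact ⟨e.symm c, rfl, Or.inl ⟨hu, by simpa using hc⟩⟩

theorem neighborSet_odd (h2 : ∀ x : S, x + x = 0) (e : Fin n ≃ Coord S l r) {u : Fin n → Bool}
    (hu : u ∉ evenVertices e) : (starCube e).neighborSet u =
      (fun c => flipAt u (e.symm c)) ''
        {c | Active ((cubeLabel e u).2 + (coordLabel c).2) c} := by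
  ext v
  simp only [mem_neighborSet, starCube, Set.mem_image, Set.mem_ofPred_eq]
  constructor
  · rintro ⟨i, rfl, ⟨h, -⟩ | ⟨-, h⟩⟩
    · exact absurd h hu
    · exact ⟨e i, by simpa [cubeLabel_flipAt h2] using h, by simp⟩
  · rintro ⟨c, hc, rfl⟩
    exact ⟨e.symm c, rfl, Or.inr ⟨(flipAt_mem_evenVertices h2 e u _).2 hu,
      by simpa [cubeLabel_flipAt h2] using hc⟩⟩

theorem setOf_active (x : S × S) (hx : x ≠ 0) :
    {c : Coord S l r | Active x c} = lowCoords l r x.1 := by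
  ext c
  rcases c with ⟨σ, _ | _⟩ | τ | a | a <;> simp [Active, lowCoords, hx]

theorem setOf_active_add_subset (h2 : ∀ x : S, x + x = 0) (x : S × S) (hx : x.1 ≠ 0) :
    {c : Coord S l r | Active (x + (coordLabel c).2) c} ⊆ lowCoords l r x.1 := by
  have hadd : ∀ σ, x.1 + σ = 0 → σ = x.1 := fun σ h => by
    rw [← h2 x.1] at h
    exact add_left_cancel h
  rintro (⟨σ, b⟩ | τ | a | a) hc
  · rcases hc with ⟨h, -⟩ | ⟨-, h⟩
    · have := hadd σ (congrArg Prod.fst h)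
      subst this
      cases b <;> simp [lowCoords]
    · simp [coordLabel, hx] at h
  · have := congrArg Prod.fst hc
    simp [coordLabel, hx] at this
  · simp [lowCoords]
  · exact hc.elim

theorem starCube_isSat [Finite S] (h2 : ∀ x : S, x + x = 0) (e : Fin n ≃ Coord S l r)
    (k : ℕ → ℕ) (hk : ∀ i : Fin 4, 3 ≤ k i) (j : Fin 4) (hmin : ∀ i : Fin 4, k j ≤ k i)
    (hl : k j = l + 3) (K : ℕ) (hKk : k j + 2 < K)
    (hK : Fintype.card (Σ i : Fin 4, Fin (k (i : ℕ) - spineExtra 4 (i : ℕ))) + 4 ≤ K)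
    (hS : K + 1 ≤ Nat.card S) :
    IsSat (hypercube n) (starCube e) (caterpillar 4 k) := by
  have hsnd : ∀ {v}, v ∈ evenVertices e → (v ∈ hubs e ↔ (cubeLabel e v).2 = 0) := by
    intro v hv
    have hv' : (cubeLabel e v).1 = 0 := hv
    simp [hubs, hv', Prod.ext_iff]
  have hfst : ∀ {v}, v ∉ evenVertices e → (v ∈ hubs e ↔ (cubeLabel e v).2.1 = 0) := by
    intro v hv
    have hv' : ¬ (cubeLabel e v).1 = 0 := hv
    simp [hubs, hv']
  have heven : ∀ {v} c, v ∈ evenVertices e → flipAt v (e.symm c) ∉ evenVertices e :=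
    fun c hv h => (flipAt_mem_evenVertices h2 e _ _).1 h hv
  have hodd : ∀ {v} c, v ∉ evenVertices e → flipAt v (e.symm c) ∈ evenVertices e :=
    fun c hv => (flipAt_mem_evenVertices h2 e _ _).2 hv
  have hlabel : ∀ v c, cubeLabel e (flipAt v (e.symm c)) = cubeLabel e v + coordLabel c := by
    intro v c
    rw [cubeLabel_flipAt h2, e.apply_symm_apply]
  have hadj : ∀ {u} c, u ∈ evenVertices e → Active (cubeLabel e u).2 c →
      (starCube e).Adj u (flipAt u (e.symm c)) := by
    intro u c hu hc
    exact ⟨e.symm c, rfl, Or.inl ⟨hu, by simpa using hc⟩⟩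
  have hsec : Function.Injective fun τ : S => (Sum.inr (Sum.inl τ) : Coord S l r) :=
    Sum.inr_injective.comp Sum.inl_injective
  have hunique : ∀ d ∉ evenVertices e, d ∈ hubs e → ∀ w ∈ hubs e, (starCube e).Adj d w →
      w = flipAt d (e.symm (Sum.inr (Sum.inl (cubeLabel e d).2.2))) := by
    intro d hd hdh w hw hdw
    have hmem : w ∈ (starCube e).neighborSet d := hdw
    rw [neighborSet_odd h2 e hd] at hmem
    obtain ⟨c, hc, rfl⟩ := hmem
    have hw0 := (hsnd (hodd c hd)).1 hw
    have hd0 := (hfst hd).1 hdh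
    rw [hlabel, Prod.snd_add] at hw0
    rw [Set.mem_ofPred_eq, hw0] at hc
    rcases c with ⟨σ, b⟩ | τ | a | a
    · have := congrArg Prod.fst hw0
      simp [coordLabel, hd0] at this
      simp [Active, this] at hc
    · have := congrArg Prod.snd hw0
      simp only [coordLabel, Prod.snd_add, Prod.snd_zero] at this
      rw [← h2 τ] at this
      rw [add_right_cancel this]
    · exact absurd rfl hc
    · exact hc.elim
  refine isSat_caterpillar (hypercube n) (starCube e) (starCube_le e) k hk j hmin K hKk hK
    (evenVertices e) (hubs e) ?_ ?_ ?_ ?_ ?_ ?_ ?_ ?_ ?_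
  · intro u v huv
    obtain ⟨i, rfl⟩ := (hypercube_adj_iff u v).1 huv
    rw [flipAt_mem_evenVertices h2, not_not]
  · intro u hu hh
    rw [neighborSet_even h2 e hu, Set.ncard_image_of_injective _ (flipAt_symm_injective e u),
      setOf_active _ fun h => hh ((hsnd hu).2 h), ncard_lowCoords]
    omega
  · intro u hu hh
    rw [neighborSet_odd h2 e hu, Set.ncard_image_of_injective _ (flipAt_symm_injective e u)]
    refine (Set.ncard_le_ncard (setOf_active_add_subset h2 _ fun h => hh ((hfst hu).2 h))
      (Set.toFinite _)).trans ?_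
    rw [ncard_lowCoords]
    omega
  · intro w hw hwh b hb hwb
    obtain ⟨i, rfl⟩ := (hypercube_adj_iff w b).1 hwb
    obtain ⟨c, rfl⟩ := e.symm.surjective i
    have hw0 := (hsnd hw).1 hwh
    rw [hfst (heven c hw), hlabel, Prod.snd_add, hw0, zero_add] at hb
    refine hadj c hw ?_
    rw [hw0]
    rcases c with ⟨σ, b⟩ | τ | a | a
    · exact Or.inl ⟨rfl, hb⟩
    · exact rfl
    · exact absurd rfl hb
    · exact absurd rfl hb
  · intro d hd hdh
    set w := flipAt d (e.symm (Sum.inr (Sum.inl (cubeLabel e d).2.2))) with hwdef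
    have hd0 := (hfst hd).1 hdh
    have hw : w ∈ evenVertices e := hodd _ hd
    have hw0 : (cubeLabel e w).2 = 0 := by
      rw [hwdef, hlabel]
      ext <;> simp [coordLabel, hd0, h2]
    refine ⟨w, (hsnd hw).2 hw0, SimpleGraph.Adj.symm ?_⟩
    have := hadj (Sum.inr (Sum.inl (cubeLabel e d).2.2)) hw (by rw [hw0]; rfl)
    rwa [hwdef, flipAt_flipAt] at this
  · intro d hd hdh w hw w' hw' h h'
    rw [hunique d hd hdh w hw h, hunique d hd hdh w' hw' h']
  · intro w hw hwh
    have hw0 := (hsnd hw).1 hwh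
    have hsub : Set.range (fun τ : S => flipAt w (e.symm (Sum.inr (Sum.inl τ)))) ⊆
        (starCube e).neighborSet w ∩ hubs e := by
      rintro _ ⟨τ, rfl⟩
      refine ⟨hadj _ hw (by rw [hw0]; rfl), (hfst (heven _ hw)).2 ?_⟩
      rw [hlabel, Prod.snd_add, hw0]
      simp [coordLabel]
    have := Set.ncard_le_ncard hsub (Set.toFinite _)
    have hcard := Set.ncard_image_of_injective Set.univ ((flipAt_symm_injective e w).comp hsec)
    rw [Set.image_univ, Set.ncard_univ] at hcard
    change (Set.range fun τ : S => flipAt w (e.symm (Sum.inr (Sum.inl τ)))).ncard = _ at hcard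
    omega
  · intro d hd hdh
    have hd0 := (hfst hd).1 hdh
    have hsub : (fun σ : S => flipAt d (e.symm (Sum.inl (σ, true)))) '' {0}ᶜ ⊆
        (starCube e).neighborSet d := by
      rintro _ ⟨σ, hσ, rfl⟩
      rw [neighborSet_odd h2 e hd]
      refine ⟨_, Or.inr ⟨fun h => hσ ?_, ?_⟩, rfl⟩
      · simpa [coordLabel, hd0] using congrArg Prod.fst h
      · simp [coordLabel, hd0]
    have hinj : Function.Injective fun σ : S => (Sum.inl (σ, true) : Coord S l r) := by
      intro σ σ' h
      simpa using h
    have := Set.ncard_le_ncard hsub (Set.toFinite _)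
    have hcard := Set.ncard_image_of_injective {0}ᶜ ((flipAt_symm_injective e d).comp hinj)
    rw [Set.ncard_compl, Set.ncard_singleton] at hcard
    change ((fun σ : S => flipAt d (e.symm (Sum.inl (σ, true)))) '' {0}ᶜ).ncard = _ at hcard
    omega
  · intro u hu hh
    have hu0 : (cubeLabel e u).2 ≠ 0 := fun h => hh ((hsnd hu).2 h)
    have hhub : ∀ b, flipAt u (e.symm (Sum.inl ((cubeLabel e u).2.1, b))) ∈ hubs e := by
      intro b
      rw [hfst (heven _ hu), hlabel]
      simp [coordLabel, h2]
    refine ⟨_, hhub true, _, hhub false, fun h => ?_, hadj _ hu (Or.inr ⟨hu0, rfl⟩),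
      hadj _ hu (Or.inr ⟨hu0, rfl⟩)⟩
    have := flipAt_symm_injective e u h
    simp at this

theorem ncard_evenVertices_le [Finite S] (h2 : ∀ x : S, x + x = 0) (e : Fin n ≃ Coord S l r) :
    (evenVertices e).ncard ≤ 2 ^ (n - 1) := by
  let i : Fin n := e.symm (Sum.inl (0, true))
  have hsub : (fun v => flipAt v i) '' evenVertices e ⊆ (evenVertices e)ᶜ := by
    rintro _ ⟨v, hv, rfl⟩ h
    exact (flipAt_mem_evenVertices h2 e v i).1 h hv
  have h1 := Set.ncard_le_ncard hsub (Set.toFinite _)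
  rw [Set.ncard_image_of_injective _ (flipAt_left_injective i)] at h1
  have h3 := Set.ncard_add_ncard_compl (evenVertices e)
  have h4 : Nat.card (Fin n → Bool) = 2 ^ (n - 1) * 2 := by
    rw [← pow_succ, Nat.sub_add_cancel (Nat.one_le_iff_ne_zero.2 (Fin.pos i).ne')]
    simp
  omega

theorem ncard_centres_mul_le [Finite S] (h2 : ∀ x : S, x + x = 0) (e : Fin n ≃ Coord S l r) :
    {v | cubeLabel e v = 0}.ncard * (Nat.card S * Nat.card S) ≤ (evenVertices e).ncard := by
  let i : S → Fin n := fun σ => e.symm (Sum.inl (σ, true))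
  let i' : S → Fin n := fun τ => e.symm (Sum.inr (Sum.inl τ))
  have hlabel : ∀ v, cubeLabel e v = 0 → ∀ σ τ,
      cubeLabel e (flipAt (flipAt v (i σ)) (i' τ)) = (0, σ, τ) := by
    intro v hv σ τ
    simp only [cubeLabel_flipAt h2, i, i', Equiv.apply_symm_apply, coordLabel, hv, zero_add,
      Prod.mk_add_mk, add_zero]
    rfl
  let φ : (Fin n → Bool) × (S × S) → Fin n → Bool :=
    fun p => flipAt (flipAt p.1 (i p.2.1)) (i' p.2.2)
  have hinj : Set.InjOn φ ({v | cubeLabel e v = 0} ×ˢ Set.univ) := by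
    rintro ⟨v, σ, τ⟩ ⟨hv, -⟩ ⟨v', σ', τ'⟩ ⟨hv', -⟩ h
    have hl := congrArg (cubeLabel e) h
    simp only [φ] at hl
    rw [hlabel v hv, hlabel v' hv'] at hl
    simp only [Prod.mk.injEq, true_and] at hl
    obtain ⟨rfl, rfl⟩ := hl
    have := flipAt_left_injective _ (flipAt_left_injective _ h)
    exact congrArg (fun v => (v, σ, τ)) this
  have hmaps : φ '' ({v | cubeLabel e v = 0} ×ˢ Set.univ) ⊆ evenVertices e := by
    rintro _ ⟨⟨v, σ, τ⟩, ⟨hv, -⟩, rfl⟩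
    exact congrArg Prod.fst (hlabel v hv σ τ)
  have := Set.ncard_le_ncard hmaps (Set.toFinite _)
  rwa [hinj.ncard_image, Set.ncard_prod, Set.ncard_univ, Nat.card_prod] at this

theorem ncard_edgeSet_starCube_le [Finite S] (h2 : ∀ x : S, x + x = 0)
    (e : Fin n ≃ Coord S l r) (hS : 3 ≤ Nat.card S) :
    (starCube e).edgeSet.ncard ≤ (l + 3) * 2 ^ (n - 1) := by
  classical
  let E := (evenVertices e).toFinset
  let W := {v | cubeLabel e v = 0}.toFinset
  have hbip : (starCube e).IsBipartiteWith (E : Set (Fin n → Bool)) (Eᶜ : Finset _) := by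
    refine ⟨by simpa using disjoint_compl_right, ?_⟩
    rintro u v ⟨i, rfl, -⟩
    have := flipAt_mem_evenVertices h2 e u i
    simp only [E, Set.coe_toFinset, Finset.coe_compl, Set.mem_compl_iff]
    tauto
  have hdeg : ∀ v ∈ E, (starCube e).degree v ≤ (2 + l) + if v ∈ W then 3 * Nat.card S else 0 := by
    intro v hv
    have hv' : v ∈ evenVertices e := by simpa [E] using hv
    have hfst : (cubeLabel e v).1 = 0 := hv'
    rw [← card_neighborFinset_eq_degree, neighborFinset, ← Set.ncard_eq_toFinset_card',
      neighborSet_even h2 e hv', Set.ncard_image_of_injective _ (flipAt_symm_injective e v)]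
    by_cases h : (cubeLabel e v).2 = 0
    · have hW : v ∈ W := by
        simpa [W] using Prod.ext hfst h
      rw [if_pos hW, h]
      refine le_trans ?_ (Nat.le_add_left _ _)
      have hsub : {c : Coord S l r | Active 0 c} ⊆
          Sum.inl '' Set.univ ∪ (fun τ => Sum.inr (Sum.inl τ)) '' Set.univ := by
        rintro (c | τ | a | a) hc
        · simp
        · simp
        · exact absurd rfl hc
        · exact hc.elim
      refine (Set.ncard_le_ncard hsub (Set.toFinite _)).trans ((Set.ncard_union_le _ _).trans ?_)
      have h3 := Set.ncard_image_le (f := (Sum.inl : S × Bool → Coord S l r)) (s := Set.univ)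
        (Set.toFinite _)
      have h4 := Set.ncard_image_le (f := fun τ : S => (Sum.inr (Sum.inl τ) : Coord S l r))
        (s := Set.univ) (Set.toFinite _)
      rw [Set.ncard_univ] at h3 h4
      rw [Nat.card_prod, Nat.card_eq_fintype_card (α := Bool), Fintype.card_bool] at h3
      omega
    · rw [setOf_active _ h, ncard_lowCoords]
      omega
  have hedges : (starCube e).edgeSet.ncard = ∑ v ∈ E, (starCube e).degree v := by
    rw [isBipartiteWith_sum_degrees_eq_card_edges hbip, edgeFinset, Set.ncard_eq_toFinset_card']
  have hsum : ∑ v ∈ E, ((2 + l) + if v ∈ W then 3 * Nat.card S else 0) ≤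
      (2 + l) * E.card + W.card * (3 * Nat.card S) := by
    rw [Finset.sum_add_distrib, Finset.sum_const, smul_eq_mul, mul_comm]
    refine Nat.add_le_add_left ?_ _
    rw [← Finset.sum_filter, Finset.sum_const, smul_eq_mul]
    refine Nat.mul_le_mul_right _ (Finset.card_le_card ?_)
    intro v hv
    exact (Finset.mem_filter.1 hv).2
  have hE : E.card = (evenVertices e).ncard := (Set.ncard_eq_toFinset_card' _).symm
  have hW : W.card * (Nat.card S * Nat.card S) ≤ E.card := by
    rw [hE, ← Set.ncard_eq_toFinset_card']
    exact ncard_centres_mul_le h2 e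
  have hE' : E.card ≤ 2 ^ (n - 1) := hE ▸ ncard_evenVertices_le h2 e
  calc (starCube e).edgeSet.ncard ≤ (2 + l) * E.card + W.card * (3 * Nat.card S) :=
        hedges ▸ (Finset.sum_le_sum hdeg).trans hsum
    _ ≤ (2 + l) * E.card + W.card * (Nat.card S * Nat.card S) := by gcongr
    _ ≤ (l + 3) * E.card := by linarith
    _ ≤ (l + 3) * 2 ^ (n - 1) := by gcongr

end Construction

/-- Upper bound for the saturation number of four-spine caterpillars, by any spine degree that
is minimal. -/
theorem satNum_caterpillar_le (k : ℕ → ℕ) (hk : ∀ i : Fin 4, 3 ≤ k i) (j : Fin 4)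
    (hmin : ∀ i : Fin 4, k j ≤ k i) :
    ∃ N : ℕ, ∀ n ≥ N, satNum (hypercube n) (caterpillar 4 k) ≤ k j * 2 ^ (n - 1) := by
  obtain ⟨l, hl⟩ := Nat.exists_eq_add_of_le' (hk j)
  let K := Fintype.card (Σ i : Fin 4, Fin (k (i : ℕ) - spineExtra 4 (i : ℕ))) + 4 + (k j + 3)
  let S := Fin (K + 1) → ZMod 2
  have h2 : ∀ x : S, x + x = 0 := fun x => funext fun i => CharTwo.add_self_eq_zero (x i)
  have hS : K + 1 ≤ Nat.card S := by
    rw [Nat.card_eq_fintype_card, Fintype.card_fun, Fintype.card_fin, ZMod.card]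
    exact Nat.lt_two_pow_self.le
  refine ⟨Fintype.card (Coord S l 0), fun n hn => ?_⟩
  obtain ⟨r, rfl⟩ := Nat.exists_eq_add_of_le hn
  have hcard : Fintype.card (Coord S l r) = Fintype.card (Coord S l 0) + r := by
    simp only [Fintype.card_sum, Fintype.card_fin]
    omega
  let e : Fin (Fintype.card (Coord S l 0) + r) ≃ Coord S l r :=
    (Fintype.equivFinOfCardEq hcard).symm
  have hsat : IsSat (hypercube _) (starCube e) (caterpillar 4 k) :=
    starCube_isSat h2 e k hk j hmin hl K (by omega) (by omega) hS
  have hsInf : satNum (hypercube _) (caterpillar 4 k) ≤ (starCube e).edgeSet.ncard :=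
    Nat.sInf_le ⟨starCube e, hsat, rfl⟩
  refine hsInf.trans ?_
  rw [hl]
  exact ncard_edgeSet_starCube_le h2 e (by omega)

/-- for the caterpillar `S_{k₁×k₂×k₃×k₄}` with all `kᵢ ≥ 3`,
`sat(Q_n, S_{k₁×k₂×k₃×k₄}) ≤ min(k₁,k₂,k₃,k₄)·2^(n-1)` for all sufficiently
large `n`. -/
theorem stmt18 (k₁ k₂ k₃ k₄ : ℕ) (h₁ : 3 ≤ k₁) (h₂ : 3 ≤ k₂) (h₃ : 3 ≤ k₃) (h₄ : 3 ≤ k₄) :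
    ∃ N : ℕ, ∀ n ≥ N,
      satNum (hypercube n)
          (caterpillar 4
            (fun t => if t = 0 then k₁ else if t = 1 then k₂ else if t = 2 then k₃ else k₄)) ≤
        min k₁ (min k₂ (min k₃ k₄)) * 2 ^ (n - 1) := by
  set k : ℕ → ℕ := fun t => if t = 0 then k₁ else if t = 1 then k₂ else if t = 2 then k₃ else k₄
  have hk : ∀ i : Fin 4, 3 ≤ k i := by
    intro i
    fin_cases i <;> simpa [k]
  obtain ⟨j, hj⟩ := Finite.exists_min fun i : Fin 4 => k i
  obtain ⟨N, hN⟩ := satNum_caterpillar_le k hk j hj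
  refine ⟨N, fun n hn => (hN n hn).trans (Nat.mul_le_mul_right _ ?_)⟩
  exact le_min (hj 0) (le_min (hj 1) (le_min (hj 2) (hj 3)))
end
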